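/- Let M₁, M₂ be graded R-modules and let f : M₁ → M₂ be a graded monomorphism. If C₂ is a graded strongly classical 2-absorbing second submodule of the graded R-module f(M₁), then f⁻¹(C₂) is a graded strongly classical 2-absorbing second submodule of M₁. -/

import Mathlib

open Pointwise

section GradedDefs

variable {G : Type*} [Group G] [DecidableEq G] {R : Type*} [CommRing R]
  {M : Type*} [AddCommGroup M] [Module R M]

/-- `R` is a `G`-graded commutative ring via the additive subgroups `𝒜 α`:
`R_α R_β ⊆ R_{αβ}` and `R = ⊕_{α ∈ G} R_α`. -/
structure IsRingGrading (𝒜 : G → AddSubgroup R) : Prop where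
  one_mem : (1 : R) ∈ 𝒜 1
  mul_mem : ∀ ⦃α β : G⦄ ⦃r s : R⦄, r ∈ 𝒜 α → s ∈ 𝒜 β → r * s ∈ 𝒜 (α * β)
  isInternal : DirectSum.IsInternal 𝒜

/-- `M` is a graded module over the `G`-graded ring `R`:
`R_α M_β ⊆ M_{αβ}` and `M = ⊕_{α ∈ G} M_α`. -/
structure IsModuleGrading (𝒜 : G → AddSubgroup R) (ℳ : G → AddSubgroup M) : Prop where
  smul_mem : ∀ ⦃α β : G⦄ ⦃r : R⦄ ⦃m : M⦄, r ∈ 𝒜 α → m ∈ ℳ β → r • m ∈ ℳ (α * β)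
  isInternal : DirectSum.IsInternal ℳ

/-- A submodule `N` of `M` is a graded submodule iff `N = ⊕_{α ∈ G} (N ∩ M_α)`,
equivalently, every element of `N` is a sum of homogeneous elements of `N`. -/
def IsGradedSubmodule (ℳ : G → AddSubgroup M) (N : Submodule R M) : Prop :=
  ∀ n ∈ N, n ∈ Submodule.span R {m : M | m ∈ N ∧ ∃ α, m ∈ ℳ α}

/-- An ideal `I` of `R` is a graded ideal iff `I = ⊕_{α ∈ G} (I ∩ R_α)`. -/
def IsGradedIdeal (𝒜 : G → AddSubgroup R) (I : Ideal R) : Prop :=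
  ∀ r ∈ I, r ∈ Ideal.span {s : R | s ∈ I ∧ ∃ α, s ∈ 𝒜 α}

/-- A proper graded submodule `C` of `M` is completely graded irreducible if whenever
`C = ⋂_{λ ∈ Δ} C_λ` for a family of graded submodules `C_λ`, then `C = C_β` for some `β`. -/
def CompletelyGradedIrreducible (ℳ : G → AddSubgroup M) (C : Submodule R M) : Prop :=
  IsGradedSubmodule ℳ C ∧ C ≠ ⊤ ∧
    ∀ S : Set (Submodule R M), (∀ D ∈ S, IsGradedSubmodule ℳ D) → C = sInf S → C ∈ S

/-- A non-zero graded submodule `C` of `M` is a graded classical 2-absorbing second submodule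
if whenever `r, s, t ∈ h(R)`, `U` is a completely graded irreducible submodule of `M` and
`r·s·t·C ⊆ U`, then `r·s·C ⊆ U` or `s·t·C ⊆ U` or `r·t·C ⊆ U`. -/
def IsGrClassical2AbsorbingSecond (𝒜 : G → AddSubgroup R) (ℳ : G → AddSubgroup M)
    (C : Submodule R M) : Prop :=
  C ≠ ⊥ ∧ IsGradedSubmodule ℳ C ∧
    ∀ r s t : R, (∃ α, r ∈ 𝒜 α) → (∃ β, s ∈ 𝒜 β) → (∃ γ, t ∈ 𝒜 γ) →
      ∀ U : Submodule R M, CompletelyGradedIrreducible ℳ U →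
        r • s • t • C ≤ U → (r • s • C ≤ U ∨ s • t • C ≤ U ∨ r • t • C ≤ U)

/-- A non-zero graded submodule `C` of `M` is a graded strongly classical 2-absorbing second
submodule if whenever `r, s, t ∈ h(R)`, `U₁, U₂, U₃` are completely graded irreducible
submodules of `M` and `r·s·t·C ⊆ U₁ ∩ U₂ ∩ U₃`, then `r·s·C ⊆ U₁ ∩ U₂ ∩ U₃` or
`s·t·C ⊆ U₁ ∩ U₂ ∩ U₃` or `r·t·C ⊆ U₁ ∩ U₂ ∩ U₃`. -/
def IsGrStronglyClassical2AbsorbingSecond (𝒜 : G → AddSubgroup R) (ℳ : G → AddSubgroup M)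
    (C : Submodule R M) : Prop :=
  C ≠ ⊥ ∧ IsGradedSubmodule ℳ C ∧
    ∀ r s t : R, (∃ α, r ∈ 𝒜 α) → (∃ β, s ∈ 𝒜 β) → (∃ γ, t ∈ 𝒜 γ) →
      ∀ U₁ U₂ U₃ : Submodule R M, CompletelyGradedIrreducible ℳ U₁ →
        CompletelyGradedIrreducible ℳ U₂ → CompletelyGradedIrreducible ℳ U₃ →
        r • s • t • C ≤ U₁ ⊓ U₂ ⊓ U₃ →
        (r • s • C ≤ U₁ ⊓ U₂ ⊓ U₃ ∨ s • t • C ≤ U₁ ⊓ U₂ ⊓ U₃ ∨ r • t • C ≤ U₁ ⊓ U₂ ⊓ U₃)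

/-- A non-zero graded submodule `S` of `M` is a graded weakly second submodule if whenever
`r, s ∈ h(R)`, `N` is a graded submodule of `M` and `r·s·S ⊆ N`, then `r·S ⊆ N` or `s·S ⊆ N`. -/
def IsGrWeaklySecond (𝒜 : G → AddSubgroup R) (ℳ : G → AddSubgroup M)
    (S : Submodule R M) : Prop :=
  S ≠ ⊥ ∧ IsGradedSubmodule ℳ S ∧
    ∀ r s : R, (∃ α, r ∈ 𝒜 α) → (∃ β, s ∈ 𝒜 β) →
      ∀ N : Submodule R M, IsGradedSubmodule ℳ N →
        r • s • S ≤ N → (r • S ≤ N ∨ s • S ≤ N)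

/-- A proper graded ideal `I` of `R` is a graded 2-absorbing ideal if whenever `r, s, t ∈ h(R)`
with `r·s·t ∈ I`, then `r·s ∈ I` or `r·t ∈ I` or `s·t ∈ I`. -/
def IsGr2AbsorbingIdeal (𝒜 : G → AddSubgroup R) (I : Ideal R) : Prop :=
  I ≠ ⊤ ∧ IsGradedIdeal 𝒜 I ∧
    ∀ r s t : R, (∃ α, r ∈ 𝒜 α) → (∃ β, s ∈ 𝒜 β) → (∃ γ, t ∈ 𝒜 γ) →
      r * s * t ∈ I → (r * s ∈ I ∨ r * t ∈ I ∨ s * t ∈ I)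

end GradedDefs

/-- The grading induced on the image `f(M₁) = range f`, namely `f(M₁) ∩ (M₂)_α`. -/
def rangeGrading {G : Type*} {R : Type*} [CommRing R] {M₁ M₂ : Type*}
    [AddCommGroup M₁] [Module R M₁] [AddCommGroup M₂] [Module R M₂]
    (f : M₁ →ₗ[R] M₂) (ℳ₂ : G → AddSubgroup M₂) :
    G → AddSubgroup ↥(LinearMap.range f) :=
  fun α => (ℳ₂ α).comap (LinearMap.range f).subtype.toAddMonoidHom

/-- An injective graded homomorphism reflects homogeneity. -/
theorem mem_grading_of_map_mem {G M₁ M₂ : Type*} [DecidableEq G] [AddCommGroup M₁] [AddCommGroup M₂]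
    {ℳ₁ : G → AddSubgroup M₁} {ℳ₂ : G → AddSubgroup M₂}
    (h₁ : DirectSum.IsInternal ℳ₁) (h₂ : DirectSum.IsInternal ℳ₂)
    (f : M₁ →+ M₂) (hfgr : ∀ α, ∀ m ∈ ℳ₁ α, f m ∈ ℳ₂ α) (hfinj : Function.Injective f)
    {α : G} {m : M₁} (hm : f m ∈ ℳ₂ α) : m ∈ ℳ₁ α := by
  obtain ⟨x, rfl⟩ := h₁.2 m
  let F : ∀ i, ℳ₁ i →+ ℳ₂ i := fun i =>
    (f.comp (ℳ₁ i).subtype).codRestrict (ℳ₂ i) fun a => hfgr i a a.2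
  have hF : ∀ y, DirectSum.coeAddMonoidHom ℳ₂ (DirectSum.map F y) =
      f (DirectSum.coeAddMonoidHom ℳ₁ y) := by
    intro y
    induction y using DirectSum.induction_on with
    | zero => simp
    | of i a =>
      rw [DirectSum.map_of, DirectSum.coeAddMonoidHom_of, DirectSum.coeAddMonoidHom_of]
      rfl
    | add a b ha hb => simp [ha, hb]
  have key : DirectSum.map F x = DirectSum.of (fun i => ℳ₂ i) α ⟨_, hm⟩ :=
    h₂.1 (by rw [hF, DirectSum.coeAddMonoidHom_of])
  have hx : x = DirectSum.of (fun i => ℳ₁ i) α (x α) := by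
    refine DFinsupp.ext fun β => ?_
    by_cases hβ : β = α
    · subst hβ
      exact (DirectSum.of_eq_same (β := fun i => ℳ₁ i) β (x β)).symm
    · have h0 : F β (x β) = 0 := by
        rw [← DirectSum.map_apply, key, DirectSum.of_eq_of_ne _ _ _ hβ]
      have h1 : f (x β) = 0 := congrArg Subtype.val h0
      have h2 : x β = 0 := Subtype.ext (hfinj (h1.trans (map_zero f).symm))
      exact h2.trans (DirectSum.of_eq_of_ne (β := fun i => ℳ₁ i) α β (x α) hβ).symm
  rw [hx, DirectSum.coeAddMonoidHom_of]
  exact (x α).2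

section Transport

variable {G R M N : Type*} [CommRing R] [AddCommGroup M] [Module R M] [AddCommGroup N] [Module R N]
  {ℳ : G → AddSubgroup M} {𝒩 : G → AddSubgroup N}

theorem IsGradedSubmodule.map_equiv (e : M ≃ₗ[R] N) (he : ∀ α m, m ∈ ℳ α → e m ∈ 𝒩 α)
    {C : Submodule R M} (hC : IsGradedSubmodule ℳ C) :
    IsGradedSubmodule 𝒩 (C.map (e : M →ₗ[R] N)) := by
  rintro _ ⟨m, hm, rfl⟩
  have h := Submodule.mem_map_of_mem (f := (e : M →ₗ[R] N)) (hC m hm)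
  rw [Submodule.map_span] at h
  refine Submodule.span_mono ?_ h
  rintro _ ⟨a, ⟨ha, α, haα⟩, rfl⟩
  exact ⟨Submodule.mem_map_of_mem ha, α, he α a haα⟩

theorem CompletelyGradedIrreducible.map_equiv (e : M ≃ₗ[R] N)
    (he : ∀ α m, m ∈ ℳ α ↔ e m ∈ 𝒩 α) {C : Submodule R M}
    (hC : CompletelyGradedIrreducible ℳ C) :
    CompletelyGradedIrreducible 𝒩 (C.map (e : M →ₗ[R] N)) := by
  obtain ⟨hgr, htop, hirr⟩ := hC
  let φ := Submodule.orderIsoMapComap e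
  have hφ : ∀ D, φ D = D.map (e : M →ₗ[R] N) := fun _ => rfl
  have hφs : ∀ D, φ.symm D = D.map (e.symm : N →ₗ[R] M) :=
    fun D => (Submodule.map_equiv_eq_comap_symm e.symm D).symm
  rw [← hφ]
  refine ⟨hgr.map_equiv e fun α m => (he α m).1, fun h => htop ((map_eq_top_iff φ).1 h), ?_⟩
  intro S hS hCS
  have hmem := hirr (φ.symm '' S) ?_ ?_
  · obtain ⟨D, hD, hDC⟩ := hmem
    rwa [← hDC, φ.apply_symm_apply]
  · rintro _ ⟨D, hD, rfl⟩
    rw [hφs]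
    exact (hS D hD).map_equiv e.symm fun α m hm => (he α _).2 (by simpa using hm)
  · rw [sInf_image, ← φ.symm.map_sInf, ← hCS, φ.symm_apply_apply]

theorem IsGrStronglyClassical2AbsorbingSecond.map_equiv {𝒜 : G → AddSubgroup R} (e : M ≃ₗ[R] N)
    (he : ∀ α m, m ∈ ℳ α ↔ e m ∈ 𝒩 α) {C : Submodule R M}
    (hC : IsGrStronglyClassical2AbsorbingSecond 𝒜 ℳ C) :
    IsGrStronglyClassical2AbsorbingSecond 𝒜 𝒩 (C.map (e : M →ₗ[R] N)) := by
  obtain ⟨hbot, hgr, habs⟩ := hC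
  refine ⟨fun h => hbot ((map_eq_bot_iff (Submodule.orderIsoMapComap e)).1 h),
    hgr.map_equiv e fun α m => (he α m).1, ?_⟩
  have he' : ∀ α n, n ∈ 𝒩 α ↔ e.symm n ∈ ℳ α := fun α n => by simp [he]
  intro r s t hr hs ht U₁ U₂ U₃ h₁ h₂ h₃
  have h := habs r s t hr hs ht _ _ _ (h₁.map_equiv e.symm he') (h₂.map_equiv e.symm he')
    (h₃.map_equiv e.symm he')
  simp only [Submodule.map_equiv_eq_comap_symm, LinearEquiv.symm_symm, ← Submodule.comap_inf,
    ← Submodule.map_le_iff_le_comap, Submodule.map_pointwise_smul] at h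
  rwa [Submodule.map_equiv_eq_comap_symm]

end Transport

theorem stmt15 {G : Type*} [Group G] [DecidableEq G] {R : Type*} [CommRing R]
    {M₁ M₂ : Type*} [AddCommGroup M₁] [Module R M₁] [AddCommGroup M₂] [Module R M₂]
    (𝒜 : G → AddSubgroup R) (ℳ₁ : G → AddSubgroup M₁) (ℳ₂ : G → AddSubgroup M₂)
    (h𝒜 : IsRingGrading 𝒜) (hℳ₁ : IsModuleGrading 𝒜 ℳ₁)
    (hℳ₂ : IsModuleGrading 𝒜 ℳ₂)
    (f : M₁ →ₗ[R] M₂) (hfgr : ∀ α : G, ∀ m ∈ ℳ₁ α, f m ∈ ℳ₂ α)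
    (hfinj : Function.Injective f)
    (C₂ : Submodule R ↥(LinearMap.range f))
    (hC₂ : IsGrStronglyClassical2AbsorbingSecond 𝒜 (rangeGrading f ℳ₂) C₂) :
    IsGrStronglyClassical2AbsorbingSecond 𝒜 ℳ₁ (Submodule.comap f.rangeRestrict C₂) := by
  let e := LinearEquiv.ofInjective f hfinj
  have he : ∀ α n, n ∈ rangeGrading f ℳ₂ α ↔ e.symm n ∈ ℳ₁ α := by
    intro α n
    obtain ⟨m, rfl⟩ := e.surjective n
    rw [e.symm_apply_apply]
    exact ⟨mem_grading_of_map_mem hℳ₁.isInternal hℳ₂.isInternal f.toAddMonoidHom hfgr hfinj,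
      hfgr α m⟩
  have h := hC₂.map_equiv e.symm he
  rwa [Submodule.map_equiv_eq_comap_symm] at h
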